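/- Let (x,y,z) be a generic purely imaginary triple of octonions, i.e. x = x₂ i, y = y₂ i + y₃ j, z = z₂ i + z₃ j + z₄ k + z₈ ℓ with real coefficients and x₂ y₃ z₈ ≠ 0, and set v = (x,y,z)ᵀ and λ = [x,y,z] ≠ 0. Then for every choice of six real parameters p, m, n, b₁, b₄, b₇ there exists a Jordan matrix A = !![p, a, conj c; conj a, m, b; c, conj b, n] satisfying A v = v λ whose diagonal entries are p, m, n and whose entry b = b₁ + b₂ i + b₃ j + b₄ k + b₅ kℓ + b₆ jℓ + b₇ iℓ + b₈ ℓ has the prescribed components b₁, b₄, b₇ and has b₅ = 0. Thus there is a 6-parameter family of Jordan matrices admitting v as an eigenvector with eigenvalue [v]. -/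

import Mathlib

noncomputable section

/-- The octonions, as the Cayley–Dickson double of the quaternions. -/
def Octonion : Type := Quaternion ℝ × Quaternion ℝ

namespace Octonion

instance : AddCommGroup Octonion :=
  inferInstanceAs (AddCommGroup (Quaternion ℝ × Quaternion ℝ))

instance : Module ℝ Octonion :=
  inferInstanceAs (Module ℝ (Quaternion ℝ × Quaternion ℝ))

/-- Cayley–Dickson multiplication: (a,b)·(c,d) = (a c − conj(d) b, d a + b conj(c)). -/
instance : Mul Octonion :=
  ⟨fun x y => (x.1 * y.1 - star y.2 * x.2, y.2 * x.1 + x.2 * star y.1)⟩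

instance : One Octonion := ⟨((1 : Quaternion ℝ), 0)⟩

/-- Octonionic conjugation: conj (a,b) = (conj a, −b). -/
def conj (x : Octonion) : Octonion := (star x.1, -x.2)

/-- Real part of an octonion. -/
def re (x : Octonion) : ℝ := x.1.re

/-- Imaginary part of an octonion. -/
def im (x : Octonion) : Octonion := x - re x • 1

/-- Embedding of the reals into the octonions. -/
def ofReal (r : ℝ) : Octonion := (((r : ℝ) : Quaternion ℝ), 0)

/-- The squared norm |w|² (the real scalar such that w · conj w = |w|² · 1). -/
def normSq (x : Octonion) : ℝ := Quaternion.normSq x.1 + Quaternion.normSq x.2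

/-- The imaginary unit i. -/
def i : Octonion := ((⟨0, 1, 0, 0⟩ : Quaternion ℝ), 0)

/-- The imaginary unit j. -/
def j : Octonion := ((⟨0, 0, 1, 0⟩ : Quaternion ℝ), 0)

/-- The imaginary unit k. -/
def k : Octonion := ((⟨0, 0, 0, 1⟩ : Quaternion ℝ), 0)

/-- The imaginary unit ℓ. -/
def l : Octonion := ((0 : Quaternion ℝ), (1 : Quaternion ℝ))

/-- The associator [x,y,z] = (xy)z − x(yz). -/
def assoc (x y z : Octonion) : Octonion := x * y * z - x * (y * z)

/-- A Jordan matrix: a 3×3 Hermitian matrix over the octonions. -/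
def IsHermitian (A : Matrix (Fin 3) (Fin 3) Octonion) : Prop :=
  ∀ p q : Fin 3, conj (A q p) = A p q

/-- The right eigenvalue equation `A v = v λ`, componentwise. -/
def Eig (A : Matrix (Fin 3) (Fin 3) Octonion) (v : Fin 3 → Octonion) (lam : Octonion) : Prop :=
  ∀ p : Fin 3, A p 0 * v 0 + A p 1 * v 1 + A p 2 * v 2 = v p * lam

end Octonion

namespace Octonion

/-- The octonion with the given eight coordinates in the Cayley–Dickson double. -/
def mk (r₀ r₁ r₂ r₃ s₀ s₁ s₂ s₃ : ℝ) : Octonion :=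
  ((⟨r₀, r₁, r₂, r₃⟩ : Quaternion ℝ), (⟨s₀, s₁, s₂, s₃⟩ : Quaternion ℝ))

section Coordinates

variable (r₀ r₁ r₂ r₃ s₀ s₁ s₂ s₃ t₀ t₁ t₂ t₃ u₀ u₁ u₂ u₃ t : ℝ)

lemma mk_add :
    mk r₀ r₁ r₂ r₃ s₀ s₁ s₂ s₃ + mk t₀ t₁ t₂ t₃ u₀ u₁ u₂ u₃ =
      mk (r₀ + t₀) (r₁ + t₁) (r₂ + t₂) (r₃ + t₃) (s₀ + u₀) (s₁ + u₁) (s₂ + u₂) (s₃ + u₃) :=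
  rfl

lemma mk_sub :
    mk r₀ r₁ r₂ r₃ s₀ s₁ s₂ s₃ - mk t₀ t₁ t₂ t₃ u₀ u₁ u₂ u₃ =
      mk (r₀ - t₀) (r₁ - t₁) (r₂ - t₂) (r₃ - t₃) (s₀ - u₀) (s₁ - u₁) (s₂ - u₂) (s₃ - u₃) :=
  rfl

lemma smul_mk :
    t • mk r₀ r₁ r₂ r₃ s₀ s₁ s₂ s₃ =
      mk (t * r₀) (t * r₁) (t * r₂) (t * r₃) (t * s₀) (t * s₁) (t * s₂) (t * s₃) :=
  rfl

lemma conj_mk :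
    conj (mk r₀ r₁ r₂ r₃ s₀ s₁ s₂ s₃) = mk r₀ (-r₁) (-r₂) (-r₃) (-s₀) (-s₁) (-s₂) (-s₃) := by
  refine Prod.ext (Quaternion.ext _ _ ?_ ?_ ?_ ?_) (Quaternion.ext _ _ ?_ ?_ ?_ ?_) <;>
    simp only [conj, Quaternion.re_star, Quaternion.imI_star, Quaternion.imJ_star,
      Quaternion.imK_star, Quaternion.re_neg, Quaternion.imI_neg, Quaternion.imJ_neg,
      Quaternion.imK_neg] <;>
    rfl

lemma ofReal_eq_mk : ofReal t = mk t 0 0 0 0 0 0 0 := rfl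

lemma one_eq_mk : (1 : Octonion) = mk 1 0 0 0 0 0 0 0 := rfl

lemma i_eq_mk : i = mk 0 1 0 0 0 0 0 0 := rfl

lemma j_eq_mk : j = mk 0 0 1 0 0 0 0 0 := rfl

lemma k_eq_mk : k = mk 0 0 0 1 0 0 0 0 := rfl

lemma l_eq_mk : l = mk 0 0 0 0 1 0 0 0 := rfl

lemma mul_def (v w : Octonion) :
    v * w = (v.1 * w.1 - star w.2 * v.2, w.2 * v.1 + v.2 * star w.1) := rfl

lemma mk_mul :
    mk r₀ r₁ r₂ r₃ s₀ s₁ s₂ s₃ * mk t₀ t₁ t₂ t₃ u₀ u₁ u₂ u₃ =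
      mk (r₀ * t₀ - r₁ * t₁ - r₂ * t₂ - r₃ * t₃ - s₀ * u₀ - s₁ * u₁ - s₂ * u₂ - s₃ * u₃)
        (r₀ * t₁ + r₁ * t₀ + r₂ * t₃ - r₃ * t₂ - s₁ * u₀ + s₀ * u₁ + s₃ * u₂ - s₂ * u₃)
        (r₀ * t₂ - r₁ * t₃ + r₂ * t₀ + r₃ * t₁ - s₂ * u₀ + s₀ * u₂ - s₃ * u₁ + s₁ * u₃)
        (r₀ * t₃ + r₁ * t₂ - r₂ * t₁ + r₃ * t₀ - s₃ * u₀ + s₀ * u₃ - s₁ * u₂ + s₂ * u₁)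
        (u₀ * r₀ - u₁ * r₁ - u₂ * r₂ - u₃ * r₃ + s₀ * t₀ + s₁ * t₁ + s₂ * t₂ + s₃ * t₃)
        (u₀ * r₁ + u₁ * r₀ + u₂ * r₃ - u₃ * r₂ - s₀ * t₁ + s₁ * t₀ - s₂ * t₃ + s₃ * t₂)
        (u₀ * r₂ - u₁ * r₃ + u₂ * r₀ + u₃ * r₁ - s₀ * t₂ + s₁ * t₃ + s₂ * t₀ - s₃ * t₁)
        (u₀ * r₃ + u₁ * r₂ - u₂ * r₁ + u₃ * r₀ - s₀ * t₃ - s₁ * t₂ + s₂ * t₁ + s₃ * t₀) := by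
  refine Prod.ext (Quaternion.ext _ _ ?_ ?_ ?_ ?_) (Quaternion.ext _ _ ?_ ?_ ?_ ?_) <;>
    simp [mul_def] <;> simp only [mk] <;> ring

end Coordinates

/-- A Hermitian matrix assembled from three real and three octonionic entries. -/
lemma isHermitian_of_entries (p m n : ℝ) (a b c : Octonion) :
    IsHermitian !![ofReal p, a, conj c; conj a, ofReal m, b; c, conj b, ofReal n] := by
  have conj_conj (w : Octonion) : conj (conj w) = w := by
    simp only [conj, star_star, neg_neg]; rfl
  have conj_ofReal (r : ℝ) : conj (ofReal r) = ofReal r := by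
    rw [ofReal_eq_mk, conj_mk]; simp
  intro p q
  fin_cases p <;> fin_cases q <;> simp [conj_conj, conj_ofReal]

/-- The associator of a triple in generic position. -/
lemma assoc_generic (x₂ y₂ y₃ z₂ z₃ z₄ z₈ : ℝ) :
    assoc (mk 0 x₂ 0 0 0 0 0 0) (mk 0 y₂ y₃ 0 0 0 0 0) (mk 0 z₂ z₃ z₄ z₈ 0 0 0) =
      mk 0 0 0 0 0 0 0 (2 * x₂ * y₃ * z₈) := by
  simp only [assoc, mk_mul, mk_sub]
  congr 1 <;> ring

/-- Solutions of the linear conditions on the components of `b` which remain after eliminating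
`a` and `c` from the eigenvalue equation. -/
lemma exists_components (x₂ y₂ y₃ z₂ z₃ z₄ z₈ p m n b₁ b₄ b₇ : ℝ)
    (hy : y₃ ≠ 0) (hz : z₈ ≠ 0) :
    ∃ b₂ b₃ b₆ : ℝ,
      b₃ * z₈ + b₇ * z₄ = 2 * x₂ * z₈ * (y₂ * y₃ + z₂ * z₃) ∧
      b₂ * z₈ - b₆ * z₄ =
        x₂ * z₈ * (x₂ ^ 2 + y₂ ^ 2 - y₃ ^ 2 + z₂ ^ 2 - z₃ ^ 2 - z₄ ^ 2 - z₈ ^ 2) ∧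
      2 * y₃ * (b₂ * z₄ + b₆ * z₈) =
        2 * b₁ * (y₂ * z₂ + y₃ * z₃) + 2 * b₃ * y₂ * z₄ + 2 * b₄ * (y₃ * z₂ - y₂ * z₃) -
          2 * b₇ * y₂ * z₈ + m * (y₂ ^ 2 + y₃ ^ 2) +
          n * (z₂ ^ 2 + z₃ ^ 2 + z₄ ^ 2 + z₈ ^ 2) - p * x₂ ^ 2 := by
  have rotate (A B : ℝ) : ∃ b₂ b₆ : ℝ, b₂ * z₈ - b₆ * z₄ = A ∧ b₂ * z₄ + b₆ * z₈ = B := by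
    have h : z₄ ^ 2 + z₈ ^ 2 ≠ 0 := by positivity
    refine ⟨(z₈ * A + z₄ * B) / (z₄ ^ 2 + z₈ ^ 2), (z₈ * B - z₄ * A) / (z₄ ^ 2 + z₈ ^ 2), ?_, ?_⟩ <;>
      field_simp <;> ring
  obtain ⟨b₃, h₃⟩ : ∃ b₃ : ℝ,
      b₃ * z₈ + b₇ * z₄ = 2 * x₂ * z₈ * (y₂ * y₃ + z₂ * z₃) :=
    ⟨(2 * x₂ * z₈ * (y₂ * y₃ + z₂ * z₃) - b₇ * z₄) / z₈, by field_simp; ring⟩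
  obtain ⟨b₂, b₆, h₂, h₆⟩ := rotate
    (x₂ * z₈ * (x₂ ^ 2 + y₂ ^ 2 - y₃ ^ 2 + z₂ ^ 2 - z₃ ^ 2 - z₄ ^ 2 - z₈ ^ 2))
    ((2 * b₁ * (y₂ * z₂ + y₃ * z₃) + 2 * b₃ * y₂ * z₄ + 2 * b₄ * (y₃ * z₂ - y₂ * z₃) -
      2 * b₇ * y₂ * z₈ + m * (y₂ ^ 2 + y₃ ^ 2) +
      n * (z₂ ^ 2 + z₃ ^ 2 + z₄ ^ 2 + z₈ ^ 2) - p * x₂ ^ 2) / (2 * y₃))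
  exact ⟨b₂, b₃, b₆, h₃, h₂, by rw [h₆]; field_simp⟩

end Octonion

open Octonion in
/-- For a generic purely imaginary triple with nonzero associator, every choice of the
six real parameters `p, m, n, b₁, b₄, b₇` yields a Jordan matrix admitting
`v = (x,y,z)ᵀ` as an eigenvector with eigenvalue `λ = [x,y,z]`, whose entry `b` has the
prescribed `1`-, `k`-, `iℓ`-components and vanishing `kℓ`-component. -/
theorem six_parameter_family (x y z : Octonion) (x₂ y₂ y₃ z₂ z₃ z₄ z₈ : ℝ)
    (hx : x = x₂ • i)
    (hy : y = y₂ • i + y₃ • j)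
    (hz : z = z₂ • i + z₃ • j + z₄ • k + z₈ • l)
    (hne : x₂ * y₃ * z₈ ≠ 0) :
    ∀ p m n b₁ b₄ b₇ : ℝ, ∃ (a b c : Octonion) (b₂ b₃ b₆ b₈ : ℝ),
      b = b₁ • 1 + b₂ • i + b₃ • j + b₄ • k + (0 : ℝ) • (k * l) + b₆ • (j * l) +
        b₇ • (i * l) + b₈ • l ∧
      IsHermitian !![ofReal p, a, conj c; conj a, ofReal m, b; c, conj b, ofReal n] ∧
      Eig !![ofReal p, a, conj c; conj a, ofReal m, b; c, conj b, ofReal n]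
        ![x, y, z] (assoc x y z) := by
  have hx₂ : x₂ ≠ 0 := by rintro rfl; simp at hne
  have hy₃ : y₃ ≠ 0 := by rintro rfl; simp at hne
  have hz₈ : z₈ ≠ 0 := by rintro rfl; simp at hne
  intro p m n b₁ b₄ b₇
  obtain ⟨b₂, b₃, b₆, h₃, h₂, h₆⟩ :=
    exists_components x₂ y₂ y₃ z₂ z₃ z₄ z₈ p m n b₁ b₄ b₇ hy₃ hz₈
  have hx' : x = mk 0 x₂ 0 0 0 0 0 0 := by simp [hx, i_eq_mk, smul_mk]
  have hy' : y = mk 0 y₂ y₃ 0 0 0 0 0 := by simp [hy, i_eq_mk, j_eq_mk, smul_mk, mk_add]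
  have hz' : z = mk 0 z₂ z₃ z₄ z₈ 0 0 0 := by
    simp [hz, i_eq_mk, j_eq_mk, k_eq_mk, l_eq_mk, smul_mk, mk_add]
  have hb : b₁ • 1 + b₂ • i + b₃ • j + b₄ • k + (0 : ℝ) • (k * l) + b₆ • (j * l) +
      b₇ • (i * l) + (2 * x₂ * z₂ * z₈) • l =
        mk b₁ b₂ b₃ b₄ (2 * x₂ * z₂ * z₈) b₇ b₆ 0 := by
    simp [one_eq_mk, i_eq_mk, j_eq_mk, k_eq_mk, l_eq_mk, smul_mk, mk_add, mk_mul]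
  -- `a` and `c` are forced by the second and third rows.
  refine ⟨x₂⁻¹ • mk (-b₁ * z₂ - b₃ * z₄ + b₄ * z₃ + b₇ * z₈ - m * y₂)
      (b₂ * z₂ + b₃ * z₃ + b₄ * z₄ + 2 * x₂ * z₂ * z₈ ^ 2)
      (-b₁ * z₄ - b₂ * z₃ + b₃ * z₂)
      (b₁ * z₃ - b₂ * z₄ + b₄ * z₂ - b₆ * z₈ + m * y₃)
      (-b₂ * z₈ + b₆ * z₄ + 2 * x₂ * z₂ ^ 2 * z₈ - 2 * x₂ * y₃ ^ 2 * z₈)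
      (b₁ * z₈ + b₆ * z₃ + b₇ * z₂)
      (b₄ * z₈ + b₆ * z₂ - b₇ * z₃ - 2 * x₂ * z₂ * z₄ * z₈)
      (-b₃ * z₈ - b₇ * z₄ + 2 * x₂ * z₂ * z₃ * z₈ + 2 * x₂ * y₂ * y₃ * z₈),
    _,
    x₂⁻¹ • mk (-b₁ * y₂ - b₄ * y₃ - n * z₂)
      (b₂ * y₂ + b₃ * y₃)
      (-b₂ * y₃ + b₃ * y₂ + n * z₄ - 2 * x₂ * y₃ * z₈ ^ 2)
      (-b₁ * y₃ + b₄ * y₂ - n * z₃)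
      (2 * x₂ * y₂ * z₂ * z₈ + 2 * x₂ * y₃ * z₃ * z₈)
      (b₆ * y₃ + b₇ * y₂ - n * z₈ - 2 * x₂ * y₃ * z₄ * z₈)
      (b₆ * y₂ - b₇ * y₃)
      0,
    b₂, b₃, b₆, 2 * x₂ * z₂ * z₈, rfl, isHermitian_of_entries _ _ _ _ _ _, ?_⟩
  rw [hb, hx', hy', hz', assoc_generic]
  intro r
  fin_cases r <;>
    simp only [Fin.zero_eta, Fin.mk_one, Fin.reduceFinMk, Matrix.of_apply, Matrix.cons_val,
      Matrix.cons_val_zero, Matrix.cons_val_one, ofReal_eq_mk, conj_mk, smul_mk, mk_mul, mk_add]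
  · congr 1
    all_goals field_simp
    case e_r₁ => linear_combination h₆
    case e_s₁ => linear_combination (-2 * y₃) * h₃
    case e_s₂ => linear_combination (2 * y₃) * h₂
    all_goals ring
  all_goals congr 1 <;> field_simp <;> ring
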